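/- Odd moments of the bifurcation ratio deviation: for every fixed r ≥ 1 and s ≥ 0, the expectation ⟨(S_{r+1,n}/S_{r,n} − 1/4)^{2s+1}⟩ under P_n is asymptotically equivalent, as n → ∞, to ((2s+1)!!/(2·4^{2s+1}))·(n/4^{r−1})^{−s−1}, i.e. the ratio of the two sides tends to 1. -/

import Mathlib

open MeasureTheory ProbabilityTheory Filter
open scoped NNReal Topology

/-- Binary trees: every internal node has exactly two children. -/
inductive BinTree : Type
  | leaf : BinTree
  | node : BinTree → BinTree → BinTree
  deriving DecidableEq

namespace BinTree

/-- The magnitude of a binary tree is its number of leaves. -/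
def magnitude : BinTree → ℕ
  | leaf => 1
  | node l r => magnitude l + magnitude r

/-- The Horton–Strahler order of (the root of) a binary tree:
leaves have order 1; a node whose two children have distinct orders has the max of the two;
a node whose two children have equal order `r` has order `r + 1`. -/
def ord : BinTree → ℕ
  | leaf => 1
  | node l r => if ord l = ord r then ord l + 1 else max (ord l) (ord r)

/-- `branches k τ` is `S_{k,n}(τ)`, the number of Horton–Strahler branches of order `k`
in `τ`, i.e. the number of maximal connected paths of nodes of order `k`.  It counts the
nodes of order `k` that head a branch: a new branch head of order `ord l + 1` is created
exactly at a node whose two children have equal order `ord l`, and every leaf heads an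
order-1 branch. -/
def branches (k : ℕ) : BinTree → ℕ
  | leaf => if k = 1 then 1 else 0
  | node l r => branches k l + branches k r +
      (if ord l = ord r ∧ ord l + 1 = k then 1 else 0)

end BinTree

/-- `treesOf n` is the finite set `Ω_n` of binary trees of magnitude `n`. -/
def treesOf : ℕ → Finset BinTree
  | 0 => ∅
  | 1 => {BinTree.leaf}
  | (n+2) => (Finset.range (n+1)).attach.biUnion fun k =>
      ((treesOf (k.1+1)) ×ˢ (treesOf (n+1-k.1))).image fun p => BinTree.node p.1 p.2
  decreasing_by
  · have := Finset.mem_range.mp k.2; omega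
  · omega

/-- Expectation `⟨f⟩` under the uniform probability measure `P_n` on `Ω_n` (the random model). -/
noncomputable def expect (n : ℕ) (f : BinTree → ℝ) : ℝ :=
  (∑ τ ∈ treesOf n, f τ) / (treesOf n).card

namespace BinTree

lemma magnitude_pos (τ : BinTree) : 0 < τ.magnitude := by
  induction τ with
  | leaf => simp [magnitude]
  | node l r hl hr => simp only [magnitude]; omega

lemma magnitude_eq_one {τ : BinTree} : τ.magnitude = 1 ↔ τ = leaf := by
  cases τ with
  | leaf => simp [magnitude]
  | node l r =>
    have := l.magnitude_pos
    have := r.magnitude_pos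
    simp only [magnitude, reduceCtorEq, iff_false]; omega

lemma ord_pos (τ : BinTree) : 0 < τ.ord := by
  cases τ with
  | leaf => simp [ord]
  | node l r =>
    have := l.ord_pos
    simp only [ord]; split_ifs <;> omega

lemma ord_eq_one {τ : BinTree} : τ.ord = 1 ↔ τ = leaf := by
  cases τ with
  | leaf => simp [ord]
  | node l r =>
    have := l.ord_pos
    have := r.ord_pos
    simp only [ord, reduceCtorEq, iff_false]; split_ifs <;> omega

lemma branches_one (τ : BinTree) : τ.branches 1 = τ.magnitude := by
  induction τ with
  | leaf => simp [branches, magnitude]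
  | node l r hl hr =>
    have := l.ord_pos
    simp [branches, magnitude, hl, hr]; omega

/-- Horton pruning: remove all branches of order `1` and contract the resulting chains.
By convention the single leaf is left unchanged. -/
def prune : BinTree → BinTree
  | leaf => leaf
  | node l r =>
    if l = leaf then prune r else if r = leaf then prune l else node (prune l) (prune r)

lemma magnitude_prune_le (τ : BinTree) : τ.prune.magnitude ≤ τ.magnitude := by
  induction τ with
  | leaf => simp [prune]
  | node l r hl hr =>
    simp only [prune]
    split_ifs <;> simp only [magnitude] <;> omega

lemma ord_prune {τ : BinTree} (h : τ ≠ leaf) : τ.prune.ord + 1 = τ.ord := by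
  induction τ with
  | leaf => exact absurd rfl h
  | node l r hl hr =>
    have h1 := l.ord_pos
    have h2 := r.ord_pos
    have h3 := l.ord_eq_one
    have h4 := r.ord_eq_one
    by_cases a : l = leaf <;> by_cases b : r = leaf
    · simp [a, b, prune, ord]
    · have := hr b
      simp only [a, prune, ord, if_true]
      split_ifs <;> grind
    · have := hl a
      simp only [a, b, prune, ord, if_true, if_false]
      split_ifs <;> grind
    · have := hl a
      have := hr b
      simp only [a, b, prune, ord, if_false]
      split_ifs <;> omega

lemma branches_prune {τ : BinTree} (h : τ ≠ leaf) {k : ℕ} (hk : 1 ≤ k) :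
    τ.prune.branches k = τ.branches (k + 1) := by
  induction τ with
  | leaf => exact absurd rfl h
  | node l r hl hr =>
    have h1 := l.ord_pos
    have h2 := r.ord_pos
    have h3 := l.ord_eq_one
    have h4 := r.ord_eq_one
    by_cases a : l = leaf <;> by_cases b : r = leaf
    · simp [a, b, prune, ord, branches, eq_comm]; omega
    · have : r.ord ≠ 1 := by grind
      have hk' : k ≠ 0 := by omega
      simp [a, prune, branches, hr b, ord, this.symm, hk']
    · have : l.ord ≠ 1 := by grind
      have hk' : k ≠ 0 := by omega
      simp [a, b, prune, branches, hl a, ord, this, hk']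
    · have o1 := ord_prune a
      have o2 := ord_prune b
      simp only [a, b, prune, branches, hl a, hr b, if_false]
      congr 1
      exact if_congr (by omega) rfl rfl

end BinTree

section

open BinTree Finset

lemma mem_treesOf {n : ℕ} {τ : BinTree} : τ ∈ treesOf n ↔ τ.magnitude = n := by
  induction n using Nat.strong_induction_on generalizing τ with
  | _ n ih =>
    match n with
    | 0 => simpa [treesOf] using τ.magnitude_pos.ne'
    | 1 => simp [treesOf, magnitude_eq_one]
    | n + 2 =>
      rw [treesOf]
      simp only [mem_biUnion, mem_attach, true_and, mem_image, mem_product, Subtype.exists,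
        mem_range, Prod.exists]
      constructor
      · rintro ⟨k, hk, l, r, ⟨hl, hr⟩, rfl⟩
        rw [ih _ (by omega)] at hl hr
        simp only [magnitude]; omega
      · intro h
        cases τ with
        | leaf => simp [magnitude] at h
        | node l r =>
          have h1 := l.magnitude_pos
          have h2 := r.magnitude_pos
          simp only [magnitude] at h
          refine ⟨l.magnitude - 1, by omega, l, r, ?_, rfl⟩
          rw [ih _ (by omega), ih _ (by omega)]
          omega

lemma treesOf_eq_biUnion {n : ℕ} (hn : n ≠ 1) :
    treesOf n = (antidiagonal n).biUnion fun p =>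
      (treesOf p.1 ×ˢ treesOf p.2).image fun q => BinTree.node q.1 q.2 := by
  ext τ
  simp only [mem_treesOf, mem_biUnion, HasAntidiagonal.mem_antidiagonal, mem_image, mem_product,
    Prod.exists]
  constructor
  · cases τ with
    | leaf => exact fun h => absurd h.symm hn
    | node l r => exact fun h => ⟨_, _, h, l, r, ⟨rfl, rfl⟩, rfl⟩
  · rintro ⟨_, _, h, l, r, ⟨rfl, rfl⟩, rfl⟩
    exact h

lemma sum_treesOf {M : Type*} [AddCommMonoid M] {n : ℕ} (hn : n ≠ 1) (f : BinTree → M) :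
    ∑ τ ∈ treesOf n, f τ =
      ∑ p ∈ antidiagonal n, ∑ l ∈ treesOf p.1, ∑ r ∈ treesOf p.2, f (node l r) := by
  rw [treesOf_eq_biUnion hn, sum_biUnion]
  · refine sum_congr rfl fun p _ => ?_
    rw [sum_image, sum_product]
    rintro ⟨a, b⟩ _ ⟨c, d⟩ _ h
    simpa using h
  · rintro ⟨a, b⟩ _ ⟨c, d⟩ _ hne
    simp only [Function.onFun, disjoint_left, mem_image, mem_product, Prod.exists, mem_treesOf]
    rintro _ ⟨l, r, ⟨rfl, rfl⟩, rfl⟩ ⟨l', r', ⟨rfl, rfl⟩, h⟩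
    simp only [node.injEq] at h
    exact hne (by rw [h.1, h.2])

lemma card_treesOf_succ (n : ℕ) : (treesOf (n + 1)).card = catalan n := by
  induction n using Nat.strong_induction_on with
  | _ n ih =>
    match n with
    | 0 => simp [treesOf]
    | n + 1 =>
      have h0 : treesOf 0 = ∅ := by simp [treesOf]
      rw [card_eq_sum_ones, sum_treesOf (by omega), catalan_succ', Nat.antidiagonal_succ_succ']
      simp only [sum_const, smul_eq_mul, mul_one, sum_cons, h0, card_empty, mul_zero, zero_mul,
        zero_add, sum_map, Function.Embedding.prodMap, Function.Embedding.coeFn_mk, Prod.map]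
      refine sum_congr rfl fun p hp => ?_
      rw [HasAntidiagonal.mem_antidiagonal] at hp
      rw [← ih p.1 (by omega), ← ih p.2 (by omega)]

/-- The generating function, by magnitude, of a weight on binary trees. -/
noncomputable def weightSeries (f : BinTree → ℝ) : PowerSeries ℝ :=
  PowerSeries.mk fun n => ∑ τ ∈ treesOf n, f τ

lemma weightSeries_leaf :
    weightSeries (fun τ => if τ = leaf then 1 else 0) = PowerSeries.X := by
  ext n
  rw [weightSeries, PowerSeries.coeff_mk, PowerSeries.coeff_X, sum_ite_eq']
  simp [mem_treesOf, magnitude, eq_comm]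

lemma weightSeries_node {f : BinTree → ℝ} (hf : f leaf = 0) {ι : Type*} (s : Finset ι)
    (g h : ι → BinTree → ℝ) (H : ∀ l r, f (node l r) = ∑ i ∈ s, g i l * h i r) :
    weightSeries f = ∑ i ∈ s, weightSeries (g i) * weightSeries (h i) := by
  ext n
  simp only [map_sum, PowerSeries.coeff_mul, weightSeries, PowerSeries.coeff_mk]
  by_cases hn : n = 1
  · subst hn
    simp [treesOf, hf, Nat.antidiagonal_succ]
  · rw [sum_treesOf hn, sum_comm]
    refine sum_congr rfl fun p _ => ?_
    simp only [H, sum_mul_sum]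
    simp_rw [sum_comm (t := s)]

/-- Indicator of the nontrivial trees whose pruning is `σ`. -/
def pruneFiber (σ τ : BinTree) : ℝ := if τ ≠ leaf ∧ τ.prune = σ then 1 else 0

lemma weightSeries_pruneFiber (σ : BinTree) :
    weightSeries (pruneFiber σ) * (1 - 2 * PowerSeries.X) ^ (2 * σ.magnitude - 1)
      = PowerSeries.X ^ (2 * σ.magnitude) := by
  induction σ with
  | leaf =>
    have h := weightSeries_node (f := pruneFiber leaf) (by simp [pruneFiber]) (univ : Finset (Fin 3))
      ![fun τ => if τ = leaf then 1 else 0, fun τ => if τ = leaf then 1 else 0, pruneFiber leaf]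
      ![pruneFiber leaf, fun τ => if τ = leaf then 1 else 0, fun τ => if τ = leaf then 1 else 0]
      (fun l r => by
        by_cases a : l = leaf <;> by_cases b : r = leaf <;>
          simp [Fin.sum_univ_three, pruneFiber, prune, a, b])
    simp only [Fin.sum_univ_three, Matrix.cons_val, weightSeries_leaf] at h
    simp only [magnitude]
    linear_combination h
  | node σ₁ σ₂ h₁ h₂ =>
    have h := weightSeries_node (f := pruneFiber (node σ₁ σ₂)) (by simp [pruneFiber])
      (univ : Finset (Fin 3))
      ![fun τ => if τ = leaf then 1 else 0, pruneFiber σ₁, pruneFiber (node σ₁ σ₂)]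
      ![pruneFiber (node σ₁ σ₂), pruneFiber σ₂, fun τ => if τ = leaf then 1 else 0]
      (fun l r => by
        by_cases a : l = leaf <;> by_cases b : r = leaf <;>
          simp [Fin.sum_univ_three, pruneFiber, prune, a, b, ← ite_and, and_comm])
    simp only [Fin.sum_univ_three, Matrix.cons_val, weightSeries_leaf] at h
    obtain ⟨a, ha⟩ := Nat.exists_eq_succ_of_ne_zero σ₁.magnitude_pos.ne'
    obtain ⟨b, hb⟩ := Nat.exists_eq_succ_of_ne_zero σ₂.magnitude_pos.ne'
    simp only [magnitude, ha, hb, Nat.succ_eq_add_one] at h₁ h₂ ⊢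
    rw [show 2 * (a + 1) - 1 = 2 * a + 1 by omega] at h₁
    rw [show 2 * (b + 1) - 1 = 2 * b + 1 by omega] at h₂
    rw [show 2 * (a + 1 + (b + 1)) - 1 = (2 * a + 1) + (2 * b + 1) + 1 by omega, mul_add 2,
      pow_add PowerSeries.X, ← h₁, ← h₂]
    linear_combination (1 - 2 * PowerSeries.X) ^ ((2 * a + 1) + (2 * b + 1)) * h

/-- The number of trees of magnitude `n` whose pruning is a given tree of magnitude `m`. -/
noncomputable def pruneCount (n m : ℕ) : ℝ := 2 ^ (n - 2 * m) * ((n - 2).choose (2 * m - 2) : ℝ)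

lemma sum_pruneFiber {n : ℕ} (hn : 2 ≤ n) (σ : BinTree) :
    ∑ τ ∈ treesOf n, pruneFiber σ τ = pruneCount n σ.magnitude := by
  have h := weightSeries_pruneFiber σ
  obtain ⟨m, hm⟩ := Nat.exists_eq_succ_of_ne_zero σ.magnitude_pos.ne'
  rw [hm, Nat.succ_eq_add_one, show 2 * (m + 1) - 1 = 2 * m + 1 by omega] at h
  have h1 := congrArg (PowerSeries.rescale (2 : ℝ))
    (PowerSeries.mk_add_choose_mul_one_sub_pow_eq_one ℝ (2 * m))
  have h2 : PowerSeries.rescale (2 : ℝ) PowerSeries.X = 2 * PowerSeries.X := by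
    rw [PowerSeries.rescale_X, map_ofNat]
  rw [map_mul, map_pow, map_sub, map_one, h2] at h1
  have h3 : weightSeries (pruneFiber σ) = PowerSeries.X ^ (2 * (m + 1)) *
      PowerSeries.rescale (2 : ℝ)
        (PowerSeries.mk fun n => ((2 * m + n).choose (2 * m) : ℝ)) := by
    rw [← h, mul_assoc, mul_comm (_ ^ _), h1, mul_one]
  have h4 := congrArg (PowerSeries.coeff n) h3
  rw [weightSeries, PowerSeries.coeff_mk, PowerSeries.coeff_X_pow_mul', PowerSeries.coeff_rescale,
    PowerSeries.coeff_mk] at h4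
  rw [h4, pruneCount, hm, Nat.succ_eq_add_one]
  split_ifs with hle
  · rw [show 2 * m + (n - 2 * (m + 1)) = n - 2 by omega, show 2 * (m + 1) - 2 = 2 * m by omega]
  · rw [Nat.choose_eq_zero_of_lt (by omega), Nat.cast_zero, mul_zero]

lemma sum_prune {n : ℕ} (hn : 2 ≤ n) (f : BinTree → ℝ) :
    ∑ τ ∈ treesOf n, f τ.prune =
      ∑ m ∈ range (n + 1), pruneCount n m * ∑ σ ∈ treesOf m, f σ := by
  have h1 : ∀ τ ∈ treesOf n, f τ.prune =
      ∑ m ∈ range (n + 1), ∑ σ ∈ treesOf m, pruneFiber σ τ * f σ := by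
    intro τ hτ
    rw [mem_treesOf] at hτ
    have h : τ ≠ leaf := by rintro rfl; simp [magnitude] at hτ; omega
    have := τ.magnitude_prune_le
    rw [sum_eq_single_of_mem τ.prune.magnitude (mem_range.mpr (by omega)),
      sum_eq_single_of_mem τ.prune (mem_treesOf.mpr rfl)]
    · simp [pruneFiber, h]
    · intro σ _ hσ
      simp [pruneFiber, hσ.symm]
    · intro m _ hm
      refine sum_eq_zero fun σ hσ => ?_
      have : τ.prune ≠ σ := by
        rintro rfl
        exact hm (mem_treesOf.mp hσ).symm
      simp [pruneFiber, this]
  rw [sum_congr rfl h1, sum_comm]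
  refine sum_congr rfl fun m _ => ?_
  rw [sum_comm, mul_sum]
  refine sum_congr rfl fun σ hσ => ?_
  rw [← sum_mul, sum_pruneFiber hn, mem_treesOf.mp hσ]

/-- The probability that a uniform random tree of magnitude `n ≥ 2` has `m` branches of order
two. -/
noncomputable def pruneProb (n m : ℕ) : ℝ :=
  pruneCount n m * (treesOf m).card / (treesOf n).card

lemma card_treesOf_pos {n : ℕ} (hn : 1 ≤ n) : 0 < (treesOf n).card := by
  obtain ⟨n, rfl⟩ := Nat.exists_eq_succ_of_ne_zero (Nat.one_le_iff_ne_zero.mp hn)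
  rw [Nat.succ_eq_add_one, card_treesOf_succ]
  have h1 := succ_mul_catalan_eq_centralBinom n
  have h2 := n.centralBinom_pos
  exact Nat.pos_of_mul_pos_left (h1 ▸ h2)

lemma card_treesOf_zero : (treesOf 0).card = 0 := by simp [treesOf]

lemma card_treesOf_rec {m : ℕ} (hm : 1 ≤ m) :
    ((m : ℝ) + 1) * (treesOf (m + 1)).card = 2 * (2 * m - 1) * (treesOf m).card := by
  obtain ⟨m, rfl⟩ := Nat.exists_eq_succ_of_ne_zero (Nat.one_le_iff_ne_zero.mp hm)
  rw [Nat.succ_eq_add_one, card_treesOf_succ, card_treesOf_succ]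
  have h1 : ((m : ℝ) + 1) * catalan m = m.centralBinom := by
    exact_mod_cast succ_mul_catalan_eq_centralBinom m
  have h2 : ((m : ℝ) + 1 + 1) * catalan (m + 1) = (m + 1).centralBinom := by
    exact_mod_cast succ_mul_catalan_eq_centralBinom (m + 1)
  have h3 : ((m : ℝ) + 1) * (m + 1).centralBinom = 2 * (2 * m + 1) * m.centralBinom := by
    exact_mod_cast Nat.succ_mul_centralBinom_succ m
  have h4 : (m : ℝ) + 1 ≠ 0 := by positivity
  apply mul_left_cancel₀ h4
  push_cast
  rw [h2, h3, ← h1]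
  ring

lemma choose_rec (a b : ℕ) :
    ((b : ℝ) + 1) * a.choose (b + 1) = ((a : ℝ) - b) * a.choose b := by
  rcases le_or_gt b a with h | h
  · have := Nat.choose_succ_right_eq a b
    rw [← Nat.cast_sub h]
    rw [mul_comm, mul_comm ((a - b : ℕ) : ℝ)]
    exact_mod_cast this
  · simp [Nat.choose_eq_zero_of_lt h, Nat.choose_eq_zero_of_lt (show a < b + 1 by omega)]

lemma pruneCount_rec {n m : ℕ} (hn : 2 ≤ n) (hm : 1 ≤ m) :
    4 * (2 * m * (2 * m - 1)) * pruneCount n (m + 1) =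
      ((n : ℝ) - 2 * m) * (n - 2 * m - 1) * pruneCount n m := by
  obtain ⟨m, rfl⟩ := Nat.exists_eq_succ_of_ne_zero (Nat.one_le_iff_ne_zero.mp hm)
  obtain ⟨a, rfl⟩ := Nat.exists_eq_add_of_le hn
  have h1 := choose_rec a (2 * m)
  have h2 := choose_rec a (2 * m + 1)
  simp only [pruneCount, Nat.succ_eq_add_one, Nat.add_sub_cancel_left]
  rw [show 2 * (m + 1 + 1) - 2 = 2 * m + 1 + 1 by omega, show 2 * (m + 1) - 2 = 2 * m by omega]
  push_cast at h1 h2 ⊢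
  have h3 : (4 : ℝ) * (2 * (m + 1) * (2 * (m + 1) - 1)) * a.choose (2 * m + 1 + 1) =
      4 * ((a - 2 * m) * (a - 2 * m - 1) * a.choose (2 * m)) := by
    linear_combination 4 * (2 * (m : ℝ) + 1) * h2 + 4 * (a - (2 * m + 1)) * h1
  rcases le_or_gt (2 * m + 2) a with h | h
  · obtain ⟨c, rfl⟩ := Nat.exists_eq_add_of_le h
    rw [show 2 + (2 * m + 2 + c) - 2 * (m + 1 + 1) = c by omega,
      show 2 + (2 * m + 2 + c) - 2 * (m + 1) = c + 2 by omega, pow_add]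
    push_cast at h3 ⊢
    linear_combination 2 ^ c * h3
  · rw [Nat.choose_eq_zero_of_lt h] at h3 ⊢
    simp only [Nat.cast_zero, mul_zero] at h3 ⊢
    linear_combination (2 ^ (2 + a - 2 * (m + 1)) / 4) * h3

lemma pruneProb_nonneg (n m : ℕ) : 0 ≤ pruneProb n m := by
  unfold pruneProb pruneCount; positivity

lemma pruneProb_zero (n : ℕ) : pruneProb n 0 = 0 := by
  simp [pruneProb, card_treesOf_zero]

lemma pruneProb_self {n : ℕ} (hn : 2 ≤ n) : pruneProb n n = 0 := by
  simp [pruneProb, pruneCount, Nat.choose_eq_zero_of_lt (show n - 2 < 2 * n - 2 by omega)]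

lemma pruneProb_rec {n : ℕ} (hn : 2 ≤ n) (m : ℕ) :
    pruneProb n (m + 1) * (4 * m * (m + 1)) =
      pruneProb n m * (((n : ℝ) - 2 * m) * (n - 2 * m - 1)) := by
  rcases m.eq_zero_or_pos with rfl | hm
  · simp [pruneProb_zero]
  have h1 := pruneCount_rec hn hm
  have h2 := card_treesOf_rec hm
  have hm' : (1 : ℝ) ≤ m := by exact_mod_cast hm
  have h3 : (2 * (2 * m - 1) : ℝ) ≠ 0 := by nlinarith
  apply mul_left_cancel₀ h3
  simp only [pruneProb]
  linear_combination (((m : ℝ) + 1) * (treesOf (m + 1)).card * h1 +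
    (((n : ℝ) - 2 * m) * (n - 2 * m - 1) * pruneCount n m) * h2) / (treesOf n).card

lemma expect_prune {n : ℕ} (hn : 2 ≤ n) (f : BinTree → ℝ) :
    _root_.expect n (fun τ => f τ.prune) =
      ∑ m ∈ range (n + 1), pruneProb n m * _root_.expect m f := by
  simp only [_root_.expect, sum_prune hn]
  rw [sum_div]
  refine sum_congr rfl fun m _ => ?_
  rcases m.eq_zero_or_pos with rfl | hm
  · simp [treesOf, pruneProb_zero]
  have : ((treesOf m).card : ℝ) ≠ 0 := by exact_mod_cast (card_treesOf_pos hm).ne'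
  rw [pruneProb, div_mul_div_comm, mul_right_comm, mul_div_mul_right _ _ this]

lemma sum_pruneProb {n : ℕ} (hn : 2 ≤ n) : ∑ m ∈ range (n + 1), pruneProb n m = 1 := by
  have h := expect_prune hn (fun _ => 1)
  have h1 : ∀ m, 1 ≤ m → _root_.expect m (fun _ => 1) = 1 := by
    intro m hm
    have := card_treesOf_pos hm
    simp [_root_.expect, this.ne']
  rw [h1 n (by omega)] at h
  rw [h]
  refine sum_congr rfl fun m _ => ?_
  rcases m.eq_zero_or_pos with rfl | hm
  · simp [pruneProb_zero]
  · rw [h1 m hm, mul_one]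

/-- The `k`-th moment of `S_{2,n} - n / 4`. -/
noncomputable def pruneMoment (k n : ℕ) : ℝ :=
  ∑ m ∈ range (n + 1), pruneProb n m * ((m : ℝ) - n / 4) ^ k

lemma pruneProb_summation_by_shift {n : ℕ} (hn : 2 ≤ n) (f : ℕ → ℝ) :
    ∑ m ∈ range (n + 1), pruneProb n m * (4 * m * (m - 1) * f m) =
      ∑ m ∈ range (n + 1), pruneProb n m * (((n : ℝ) - 2 * m) * (n - 2 * m - 1) * f (m + 1)) := by
  rw [sum_range_succ', sum_range_succ _ n, pruneProb_self hn, pruneProb_zero, zero_mul, zero_mul]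
  congr 1
  refine sum_congr rfl fun m _ => ?_
  have := pruneProb_rec hn m
  push_cast
  linear_combination f (m + 1) * this

lemma pruneMoment_rec {n : ℕ} (hn : 2 ≤ n) (k : ℕ) :
    (4 * (n : ℝ) - 6) * pruneMoment (k + 1) n = n / 2 * pruneMoment k n +
      ∑ j ∈ range k, (k.choose j : ℝ) * (((n : ℝ) ^ 2 / 4 - n / 2) * pruneMoment j n +
        (2 - 2 * n) * pruneMoment (j + 1) n + 4 * pruneMoment (j + 2) n) := by
  have h := pruneProb_summation_by_shift hn fun m => ((m : ℝ) - n / 4) ^ k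
  have h1 : ∀ m : ℕ, ((m + 1 : ℕ) - (n : ℝ) / 4) ^ k = ((m : ℝ) - n / 4) ^ k +
      ∑ j ∈ range k, (k.choose j : ℝ) * ((m : ℝ) - n / 4) ^ j := by
    intro m
    rw [show ((m + 1 : ℕ) - (n : ℝ) / 4) = ((m : ℝ) - n / 4) + 1 by push_cast; ring, add_pow,
      sum_range_succ, add_comm]
    simp [mul_comm]
  have h2 : ∑ j ∈ range k, (k.choose j : ℝ) * (((n : ℝ) ^ 2 / 4 - n / 2) * pruneMoment j n +
        (2 - 2 * n) * pruneMoment (j + 1) n + 4 * pruneMoment (j + 2) n) =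
      ∑ m ∈ range (n + 1), pruneProb n m * (((n : ℝ) - 2 * m) * (n - 2 * m - 1) *
        ∑ j ∈ range k, (k.choose j : ℝ) * ((m : ℝ) - n / 4) ^ j) := by
    simp only [pruneMoment, mul_sum, ← sum_add_distrib]
    rw [sum_comm]
    refine sum_congr rfl fun m _ => sum_congr rfl fun j _ => ?_
    ring
  rw [h2]
  simp only [h1] at h
  simp only [mul_add, sum_add_distrib] at h
  rw [← sub_eq_iff_eq_add', ← sub_eq_iff_eq_add'.mpr h]
  simp only [pruneMoment, mul_sum, ← sum_sub_distrib]
  refine sum_congr rfl fun m _ => ?_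
  ring

lemma pruneMoment_rec_succ {n : ℕ} (hn : 2 ≤ n) (k : ℕ) :
    (4 * (n : ℝ) - (4 * k + 10)) * pruneMoment (k + 2) n = n / 2 * pruneMoment (k + 1) n +
      (∑ j ∈ range (k + 1), ((k + 1).choose j : ℝ) * (((n : ℝ) ^ 2 / 4 - n / 2) * pruneMoment j n +
        (2 - 2 * n) * pruneMoment (j + 1) n)) +
      ∑ j ∈ range k, ((k + 1).choose j : ℝ) * (4 * pruneMoment (j + 2) n) := by
  have h := pruneMoment_rec hn (k + 1)
  simp only [mul_add ((Nat.choose _ _ : ℕ) : ℝ), sum_add_distrib] at h ⊢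
  rw [sum_range_succ (fun j => ((k + 1).choose j : ℝ) * (4 * pruneMoment (j + 2) n))] at h
  rw [Nat.choose_succ_self_right] at h
  push_cast at h
  linear_combination h

/-- The limits of the rescaled moments `pruneMoment k n / n ^ (k / 2)`. -/
noncomputable def momentLimit : ℕ → ℝ
  | 0 => 1
  | 1 => 1 / 8
  | k + 2 => (k + 1) / 16 * momentLimit k + if Even k then 0 else momentLimit (k + 1) / 8

lemma momentLimit_two_mul_add_two (s : ℕ) :
    momentLimit (2 * s + 2) = (2 * s + 1) / 16 * momentLimit (2 * s) := by
  simp [momentLimit]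

lemma momentLimit_closed_form (s : ℕ) :
    momentLimit (2 * s) = ((2 * s + 1).doubleFactorial : ℝ) / ((2 * s + 1) * 16 ^ s) ∧
    momentLimit (2 * s + 1) = ((2 * s + 1).doubleFactorial : ℝ) / (8 * 16 ^ s) := by
  induction s with
  | zero => simp [momentLimit]
  | succ s ih =>
    obtain ⟨h1, h2⟩ := ih
    have h3 : momentLimit (2 * (s + 1)) =
        ((2 * s + 1).doubleFactorial : ℝ) / 16 ^ (s + 1) := by
      rw [mul_add 2, mul_one, momentLimit_two_mul_add_two, h1]
      field_simp
      ring
    have h4 : momentLimit (2 * (s + 1) + 1) =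
        (2 * s + 2) / 16 * momentLimit (2 * s + 1) + momentLimit (2 * (s + 1)) / 8 := by
      rw [show 2 * (s + 1) + 1 = (2 * s + 1) + 2 by omega, momentLimit,
        if_neg (by simp)]
      push_cast
      ring_nf
    have h5 : (2 * (s + 1) + 1).doubleFactorial = (2 * s + 3) * (2 * s + 1).doubleFactorial := by
      rw [show 2 * (s + 1) + 1 = (2 * s + 1) + 2 by omega, Nat.doubleFactorial_add_two]
    rw [h4, h3, h2, h5]
    push_cast
    constructor <;> field_simp <;> ring

lemma tendsto_div_pow_of_lt {u : ℕ → ℝ} {a b : ℕ} {c : ℝ} (hab : a < b)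
    (h : Tendsto (fun n : ℕ => u n / (n : ℝ) ^ a) atTop (𝓝 c)) :
    Tendsto (fun n : ℕ => u n / (n : ℝ) ^ b) atTop (𝓝 0) := by
  have h1 : Tendsto (fun n : ℕ => ((n : ℝ) ^ (b - a))⁻¹) atTop (𝓝 0) :=
    ((tendsto_pow_atTop (by omega)).comp tendsto_natCast_atTop_atTop).inv_tendsto_atTop
  have h2 := h.mul h1
  rw [mul_zero] at h2
  refine h2.congr fun n => ?_
  rw [div_mul_eq_mul_div, ← div_eq_mul_inv, div_div, ← pow_add]
  congr 2; omega

/-- The limit of `pruneMoment k n / n ^ p`, for `k / 2 ≤ p`. -/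
noncomputable def momentLimitAt (k p : ℕ) : ℝ := if k / 2 = p then momentLimit k else 0

lemma momentLimitAt_of_lt {k p : ℕ} (h : k / 2 < p) : momentLimitAt k p = 0 :=
  if_neg h.ne

lemma momentLimitAt_sum (k : ℕ) :
    1 / 2 * momentLimitAt (k + 1) (k / 2 + 1) + (∑ j ∈ range (k + 1), ((k + 1).choose j : ℝ) *
      (1 / 4 * momentLimitAt j (k / 2) + -2 * momentLimitAt (j + 1) (k / 2 + 1))) =
      4 * momentLimit (k + 2) := by
  rcases Nat.even_or_odd' k with ⟨s, rfl | rfl⟩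
  · rw [sum_range_succ, sum_eq_zero, momentLimitAt_of_lt (show (2 * s + 1) / 2 < _ by omega),
      momentLimit_two_mul_add_two, momentLimitAt, if_pos rfl, Nat.choose_succ_self_right]
    · push_cast; ring
    · intro j hj
      rw [mem_range] at hj
      rw [momentLimitAt_of_lt (by omega), momentLimitAt_of_lt (by omega)]
      simp
  · have e : (2 * s + 1) / 2 = s := by omega
    rw [e, sum_range_succ, sum_range_succ, sum_eq_zero,
      momentLimitAt_of_lt (show (2 * s + 1) / 2 < s + 1 by omega)]
    · simp only [momentLimitAt]
      rw [if_pos (by omega), if_pos (by omega), if_pos (by omega), Nat.choose_succ_self_right,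
        momentLimit.eq_3 (2 * s + 1), if_neg (by simp), ← Nat.choose_symm (by omega),
        show 2 * s + 1 + 1 - 2 * s = 2 by omega, Nat.cast_choose_two,
        momentLimit_two_mul_add_two]
      push_cast; ring
    · intro j hj
      rw [mem_range] at hj
      rw [momentLimitAt_of_lt (by omega), momentLimitAt_of_lt (by omega)]
      simp

lemma tendsto_pruneMoment (k : ℕ) :
    Tendsto (fun n : ℕ => pruneMoment k n / (n : ℝ) ^ (k / 2)) atTop (𝓝 (momentLimit k)) := by
  have hinv : Tendsto (fun n : ℕ => ((n : ℝ))⁻¹) atTop (𝓝 0) :=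
    tendsto_natCast_atTop_atTop.inv_tendsto_atTop
  have hlin (a : ℝ) : Tendsto (fun n : ℕ => (4 - a * (n : ℝ)⁻¹)) atTop (𝓝 4) := by
    simpa using (hinv.const_mul a).const_sub 4
  have hpos : ∀ᶠ n : ℕ in atTop, 2 ≤ n := eventually_ge_atTop 2
  have h0 : ∀ n, 2 ≤ n → pruneMoment 0 n = 1 := fun n hn => by
    simp [pruneMoment, sum_pruneProb hn]
  induction k using Nat.strong_induction_on with
  | _ k ih =>
    match k with
    | 0 =>
      refine tendsto_const_nhds.congr' ?_
      filter_upwards [hpos] with n hn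
      simp [h0 n hn, momentLimit]
    | 1 =>
      have h := (hlin 6).inv₀ (by norm_num) |>.const_mul (1 / 2)
      rw [show (1 / 2 : ℝ) * 4⁻¹ = momentLimit 1 by norm_num [momentLimit]] at h
      refine h.congr' ?_
      filter_upwards [hpos] with n hn
      have h1 := pruneMoment_rec hn 0
      rw [h0 n hn] at h1
      have hn' : (2 : ℝ) ≤ n := by exact_mod_cast hn
      have h2 : 4 * (n : ℝ) - 6 ≠ 0 := by linarith
      have h3 : (4 : ℝ) - 6 * (n : ℝ)⁻¹ ≠ 0 := by
        have : (n : ℝ) ≠ 0 := by positivity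
        field_simp
        exact div_ne_zero h2 this
      simp only [range_zero, sum_empty, add_zero, zero_add, mul_one] at h1
      simp only [Nat.reduceDiv, pow_zero, div_one]
      rw [← div_eq_mul_inv, div_eq_iff h3]
      field_simp
      linear_combination -2 * h1
    | k + 2 =>
      have hL : ∀ j p, j < k + 2 → j / 2 ≤ p → Tendsto
          (fun n : ℕ => pruneMoment j n / (n : ℝ) ^ p) atTop (𝓝 (momentLimitAt j p)) := by
        intro j p hj hp
        rcases hp.eq_or_lt with h | h
        · rw [momentLimitAt, if_pos h, ← h]
          exact ih j hj
        · rw [momentLimitAt_of_lt h]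
          exact tendsto_div_pow_of_lt h (ih j hj)
      obtain ⟨q, hq⟩ : ∃ q, q = k / 2 := ⟨_, rfl⟩
      have hq' : (k + 2) / 2 = q + 1 := by omega
      have t1 := (hL (k + 1) (q + 1) (by omega) (by omega)).const_mul (1 / 2)
      have t2 : Tendsto (fun n : ℕ => ∑ j ∈ range (k + 1), ((k + 1).choose j : ℝ) *
          ((1 / 4 - 1 / 2 * (n : ℝ)⁻¹) * (pruneMoment j n / (n : ℝ) ^ q) +
            (-2 + 2 * (n : ℝ)⁻¹) * (pruneMoment (j + 1) n / (n : ℝ) ^ (q + 1)))) atTop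
          (𝓝 (∑ j ∈ range (k + 1), ((k + 1).choose j : ℝ) *
            (1 / 4 * momentLimitAt j q + -2 * momentLimitAt (j + 1) (q + 1)))) := by
        refine tendsto_finsetSum _ fun j hj => ?_
        rw [mem_range] at hj
        refine Tendsto.const_mul _ (.add (.mul ?_ (hL _ _ (by omega) (by omega)))
          (.mul ?_ (hL _ _ (by omega) (by omega))))
        · simpa using (hinv.const_mul (2⁻¹)).const_sub (4⁻¹ : ℝ)
        · simpa using (hinv.const_mul 2).const_add (-2 : ℝ)
      have t3 : Tendsto (fun n : ℕ => ∑ j ∈ range k, ((k + 1).choose j : ℝ) *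
          (4 * (pruneMoment (j + 2) n / (n : ℝ) ^ (q + 2)))) atTop
          (𝓝 (∑ j ∈ range k, ((k + 1).choose j : ℝ) * (4 * 0))) := by
        refine tendsto_finsetSum _ fun j hj => ?_
        rw [mem_range] at hj
        have := hL (j + 2) (q + 2) (by omega) (by omega)
        rw [momentLimitAt_of_lt (by omega)] at this
        exact (this.const_mul 4).const_mul _
      have t := ((t1.add t2).add t3).div (hlin (4 * k + 10)) (by norm_num)
      rw [hq, momentLimitAt_sum, ← hq] at t
      simp only [mul_zero, sum_const_zero, add_zero] at t
      rw [mul_div_cancel_left₀ _ (by norm_num)] at t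
      rw [hq']
      refine t.congr' ?_
      filter_upwards [hpos, eventually_ge_atTop (k + 3)] with n hn hnk
      have h1 := pruneMoment_rec_succ hn k
      have hn0 : (n : ℝ) ≠ 0 := by positivity
      have hnk' : (k : ℝ) + 3 ≤ n := by exact_mod_cast hnk
      have h3 : (4 : ℝ) - (4 * k + 10) * (n : ℝ)⁻¹ ≠ 0 := by
        field_simp
        exact div_ne_zero (by linarith) hn0
      rw [Pi.div_apply]
      rw [div_eq_iff h3]
      have h4 : pruneMoment (k + 2) n / (n : ℝ) ^ (q + 1) * (4 - (4 * k + 10) * (n : ℝ)⁻¹) =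
          ((4 * (n : ℝ) - (4 * k + 10)) * pruneMoment (k + 2) n) / (n : ℝ) ^ (q + 2) := by
        field_simp
        ring
      rw [h4, h1, add_div, add_div, sum_div, sum_div]
      congr 1
      · congr 1
        · field_simp
          ring
        · refine sum_congr rfl fun j _ => ?_
          field_simp
          ring
      · refine sum_congr rfl fun j _ => ?_
        field_simp

lemma tendsto_pow_mul_sum_pruneProb {g : ℕ → ℝ} {p : ℕ} {c : ℝ}
    (hg : Tendsto (fun m : ℕ => (m : ℝ) ^ p * g m) atTop (𝓝 c)) :
    Tendsto (fun n : ℕ => (n : ℝ) ^ p * ∑ m ∈ range (n + 1), pruneProb n m * g m) atTop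
      (𝓝 (c * 4 ^ p)) := by
  obtain ⟨B, hB⟩ : ∃ B, ∀ m : ℕ, |(m : ℝ) ^ p * g m| ≤ B := by
    obtain ⟨B, hB⟩ := (Metric.isBounded_range_of_tendsto _ hg).exists_norm_le
    exact ⟨B, fun m => hB _ ⟨m, rfl⟩⟩
  have hB0 : 0 ≤ B := (abs_nonneg _).trans (hB 0)
  have hcont : ContinuousAt (fun z : ℝ × ℝ => z.2 / z.1 ^ p) (1 / 4, c) :=
    continuousAt_snd.div (continuousAt_fst.pow p) (pow_ne_zero _ (by norm_num))
  rw [Metric.tendsto_atTop]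
  intro ε hε
  obtain ⟨δ', hδ', hφ⟩ := Metric.continuousAt_iff.mp hcont (ε / 2) (half_pos hε)
  obtain ⟨δ, hδ, hδ8, hδδ⟩ : ∃ δ > 0, δ ≤ 1 / 8 ∧ δ ≤ δ' :=
    ⟨min (1 / 8) δ', lt_min (by norm_num) hδ', min_le_left _ _, min_le_right _ _⟩
  obtain ⟨N₀, hN₀⟩ := Metric.tendsto_atTop.mp hg δ' hδ'
  set C := (B + |c| * 4 ^ p) / δ ^ (2 * (p + 1)) with hC
  have hC0 : 0 ≤ C := by positivity
  have htail : Tendsto (fun n : ℕ => C * (pruneMoment (2 * (p + 1)) n / (n : ℝ) ^ (p + 2))) atTop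
      (𝓝 0) := by
    have h := tendsto_pruneMoment (2 * (p + 1))
    rw [Nat.mul_div_cancel_left _ two_pos] at h
    simpa using (tendsto_div_pow_of_lt (show p + 1 < p + 2 by omega) h).const_mul C
  have hev := htail.eventually_lt_const (half_pos hε)
  obtain ⟨N, hN⟩ := eventually_atTop.mp (hev.and (eventually_ge_atTop (8 * N₀ + 2)))
  refine ⟨N, fun n hn => ?_⟩
  obtain ⟨htn, hn8⟩ := hN n hn
  have hn2 : 2 ≤ n := by omega
  have hn0 : (0 : ℝ) < n := by positivity
  have hn1 : (1 : ℝ) ≤ n := by exact_mod_cast (by omega : 1 ≤ n)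
  have hnp : (1 : ℝ) ≤ (n : ℝ) ^ p := one_le_pow₀ hn1
  have hpt : ∀ m : ℕ, 1 ≤ m → |(n : ℝ) ^ p * g m - c * 4 ^ p| ≤
      ε / 2 + C * (n : ℝ) ^ p / (n : ℝ) ^ (2 * (p + 1)) * ((m : ℝ) - n / 4) ^ (2 * (p + 1)) := by
    intro m hm
    have hm0 : (0 : ℝ) < m := by positivity
    have hm1 : (1 : ℝ) ≤ m := by exact_mod_cast hm
    have heven : ∀ x : ℝ, x ^ (2 * (p + 1)) = |x| ^ (2 * (p + 1)) := fun x =>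
      ((even_two_mul _).pow_abs x).symm
    rcases lt_or_ge |(m : ℝ) / n - 1 / 4| δ with h | h
    · have hmn : (n : ℝ) / 8 ≤ m := by
        have := (abs_lt.mp h).1
        have h' : (1 : ℝ) / 8 ≤ m / n := by linarith
        rw [le_div_iff₀ hn0] at h'
        linarith
      have hmN : N₀ ≤ m := by
        have h' : (8 * N₀ + 2 : ℝ) ≤ n := by exact_mod_cast hn8
        have h'' : (N₀ : ℝ) ≤ m := by linarith
        exact_mod_cast h''
      have hd : dist ((m : ℝ) / n, (m : ℝ) ^ p * g m) ((1 / 4 : ℝ), c) < δ' := by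
        rw [Prod.dist_eq, max_lt_iff]
        exact ⟨h.trans_le hδδ, hN₀ m hmN⟩
      have h1 := hφ hd
      rw [Real.dist_eq] at h1
      have h2 : (m : ℝ) ^ p * g m / ((m : ℝ) / n) ^ p = (n : ℝ) ^ p * g m := by
        rw [div_pow]; field_simp
      have h3 : c / (1 / 4 : ℝ) ^ p = c * 4 ^ p := by
        rw [one_div, inv_pow, div_inv_eq_mul]
      simp only [h2, h3] at h1
      have : 0 ≤ C * (n : ℝ) ^ p / (n : ℝ) ^ (2 * (p + 1)) *
          ((m : ℝ) - n / 4) ^ (2 * (p + 1)) := by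
        exact mul_nonneg (by positivity) ((even_two_mul _).pow_nonneg _)
      linarith
    · have h1 : |g m| ≤ B := by
        refine le_trans ?_ (hB m)
        rw [abs_mul, abs_of_nonneg (by positivity : (0 : ℝ) ≤ (m : ℝ) ^ p)]
        exact le_mul_of_one_le_left (abs_nonneg _) (one_le_pow₀ hm1)
      have h2 : |(n : ℝ) ^ p * g m - c * 4 ^ p| ≤ (n : ℝ) ^ p * (B + |c| * 4 ^ p) := by
        calc |(n : ℝ) ^ p * g m - c * 4 ^ p| ≤ |(n : ℝ) ^ p * g m| + |c * 4 ^ p| := abs_sub _ _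
          _ = (n : ℝ) ^ p * |g m| + |c| * 4 ^ p := by
            rw [abs_mul, abs_mul, abs_of_nonneg (by positivity : (0 : ℝ) ≤ (n : ℝ) ^ p),
              abs_of_nonneg (by positivity : (0 : ℝ) ≤ 4 ^ p)]
          _ ≤ (n : ℝ) ^ p * B + (n : ℝ) ^ p * (|c| * 4 ^ p) :=
            add_le_add (by gcongr) (le_mul_of_one_le_left (by positivity) hnp)
          _ = _ := by ring
      have h3 : δ ^ (2 * (p + 1)) ≤ ((m : ℝ) - n / 4) ^ (2 * (p + 1)) / (n : ℝ) ^ (2 * (p + 1)) := by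
        rw [← div_pow, show ((m : ℝ) - n / 4) / n = m / n - 1 / 4 by field_simp,
          heven (m / n - 1 / 4)]
        exact pow_le_pow_left₀ hδ.le h _
      have h4 : (n : ℝ) ^ p * (B + |c| * 4 ^ p) ≤
          C * (n : ℝ) ^ p / (n : ℝ) ^ (2 * (p + 1)) * ((m : ℝ) - n / 4) ^ (2 * (p + 1)) := by
        calc (n : ℝ) ^ p * (B + |c| * 4 ^ p) = C * (n : ℝ) ^ p * δ ^ (2 * (p + 1)) := by
              rw [hC]; field_simp
          _ ≤ C * (n : ℝ) ^ p *
              (((m : ℝ) - n / 4) ^ (2 * (p + 1)) / (n : ℝ) ^ (2 * (p + 1))) := by gcongr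
          _ = _ := by ring
      linarith
  have hsum : (n : ℝ) ^ p * ∑ m ∈ range (n + 1), pruneProb n m * g m - c * 4 ^ p =
      ∑ m ∈ range (n + 1), pruneProb n m * ((n : ℝ) ^ p * g m - c * 4 ^ p) := by
    simp only [mul_sub, sum_sub_distrib, ← sum_mul, sum_pruneProb hn2, one_mul, mul_sum]
    congr 1
    exact sum_congr rfl fun m _ => by ring
  rw [Real.dist_eq, hsum]
  calc _ ≤ ∑ m ∈ range (n + 1), |pruneProb n m * ((n : ℝ) ^ p * g m - c * 4 ^ p)| :=
        abs_sum_le_sum_abs _ _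
    _ ≤ ∑ m ∈ range (n + 1), pruneProb n m * (ε / 2 +
          C * (n : ℝ) ^ p / (n : ℝ) ^ (2 * (p + 1)) * ((m : ℝ) - n / 4) ^ (2 * (p + 1))) := by
        refine sum_le_sum fun m _ => ?_
        rcases m.eq_zero_or_pos with rfl | hm
        · simp [pruneProb_zero]
        · rw [abs_mul, abs_of_nonneg (pruneProb_nonneg n m)]
          exact mul_le_mul_of_nonneg_left (hpt m hm) (pruneProb_nonneg n m)
    _ = ε / 2 + C * (pruneMoment (2 * (p + 1)) n / (n : ℝ) ^ (p + 2)) := by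
        simp only [mul_add (pruneProb _ _), sum_add_distrib, ← sum_mul, sum_pruneProb hn2, one_mul]
        congr 1
        rw [pruneMoment, sum_div, mul_sum]
        refine sum_congr rfl fun m _ => ?_
        rw [show 2 * (p + 1) = p + (p + 2) by ring, pow_add (n : ℝ) p]
        field_simp
    _ < ε := by linarith

lemma expect_congr {n : ℕ} {f g : BinTree → ℝ} (h : ∀ τ ∈ treesOf n, f τ = g τ) :
    _root_.expect n f = _root_.expect n g := by
  rw [_root_.expect, sum_congr rfl h, _root_.expect]

lemma expect_eq_of_forall {n : ℕ} (hn : 1 ≤ n) {f : BinTree → ℝ} {c : ℝ}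
    (h : ∀ τ ∈ treesOf n, f τ = c) : _root_.expect n f = c := by
  have : ((treesOf n).card : ℝ) ≠ 0 := by exact_mod_cast (card_treesOf_pos hn).ne'
  rw [_root_.expect, sum_congr rfl h, sum_const, nsmul_eq_mul, mul_div_cancel_left₀ _ this]

lemma ne_leaf_of_mem_treesOf {n : ℕ} (hn : 2 ≤ n) {τ : BinTree} (hτ : τ ∈ treesOf n) :
    τ ≠ leaf := by
  rintro rfl
  rw [mem_treesOf, magnitude] at hτ
  omega

lemma expect_bifurcation_one {n : ℕ} (hn : 2 ≤ n) (k : ℕ) :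
    _root_.expect n (fun τ => ((branches 2 τ : ℝ) / (branches 1 τ : ℝ) - 1 / 4) ^ k) =
      pruneMoment k n / (n : ℝ) ^ k := by
  have h1 : ∀ τ ∈ treesOf n, ((branches 2 τ : ℝ) / (branches 1 τ : ℝ) - 1 / 4) ^ k =
      ((τ.prune.magnitude : ℝ) / n - 1 / 4) ^ k := by
    intro τ hτ
    rw [← branches_prune (ne_leaf_of_mem_treesOf hn hτ) le_rfl, branches_one, branches_one,
      mem_treesOf.mp hτ]
  have hn0 : (n : ℝ) ≠ 0 := by positivity
  rw [expect_congr h1, expect_prune hn (fun σ => ((σ.magnitude : ℝ) / n - 1 / 4) ^ k),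
    pruneMoment, sum_div]
  refine sum_congr rfl fun m _ => ?_
  rcases m.eq_zero_or_pos with rfl | hm
  · simp [pruneProb_zero]
  · rw [expect_eq_of_forall hm (c := ((m : ℝ) / n - 1 / 4) ^ k)
      fun σ hσ => by rw [mem_treesOf.mp hσ], mul_div_assoc, ← div_pow]
    congr 2
    field_simp

lemma expect_bifurcation_succ {n r : ℕ} (hn : 2 ≤ n) (hr : 1 ≤ r) (k : ℕ) :
    _root_.expect n (fun τ =>
      ((branches (r + 1 + 1) τ : ℝ) / (branches (r + 1) τ : ℝ) - 1 / 4) ^ k) =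
      ∑ m ∈ range (n + 1), pruneProb n m * _root_.expect m (fun τ =>
        ((branches (r + 1) τ : ℝ) / (branches r τ : ℝ) - 1 / 4) ^ k) := by
  rw [← expect_prune hn]
  refine expect_congr fun τ hτ => ?_
  have h := ne_leaf_of_mem_treesOf hn hτ
  rw [branches_prune h hr, branches_prune h (by omega)]

lemma tendsto_pow_mul_expect_bifurcation (r s : ℕ) :
    Tendsto (fun n : ℕ => (n : ℝ) ^ (s + 1) * _root_.expect n (fun τ =>
      ((branches (r + 1 + 1) τ : ℝ) / (branches (r + 1) τ : ℝ) - 1 / 4) ^ (2 * s + 1))) atTop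
      (𝓝 (((2 * s + 1).doubleFactorial : ℝ) / (2 * 4 ^ (2 * s + 1)) * (4 ^ r) ^ (s + 1))) := by
  induction r with
  | zero =>
    have h := tendsto_pruneMoment (2 * s + 1)
    rw [(momentLimit_closed_form s).2, show (2 * s + 1) / 2 = s by omega] at h
    have e : (2 : ℝ) * 4 ^ (2 * s + 1) = 8 * 16 ^ s := by
      rw [pow_succ, pow_mul]; norm_num; ring
    rw [pow_zero, one_pow, mul_one, e]
    refine h.congr' ?_
    filter_upwards [eventually_ge_atTop 2] with n hn
    rw [expect_bifurcation_one hn]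
    have hn0 : (n : ℝ) ≠ 0 := by positivity
    field_simp
    ring
  | succ r ih =>
    have h := tendsto_pow_mul_sum_pruneProb ih
    rw [mul_assoc, ← mul_pow, ← pow_succ] at h
    refine h.congr' ?_
    filter_upwards [eventually_ge_atTop 2] with n hn
    rw [expect_bifurcation_succ hn (by omega)]

end

/-- Odd moments of the bifurcation ratio deviation (Lemma 1, odd case): for `r ≥ 1`, `s ≥ 0`,
`⟨(S_{r+1,n}/S_{r,n} − 1/4)^{2s+1}⟩ ∼ ((2s+1)!!/(2·4^{2s+1})) (n/4^{r−1})^{−s−1}`. -/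
theorem odd_moments_bifurcation_ratio (r s : ℕ) (hr : 1 ≤ r) :
    Tendsto (fun n : ℕ =>
        expect n (fun τ =>
            ((BinTree.branches (r+1) τ : ℝ) / (BinTree.branches r τ : ℝ) - 1/4) ^ (2*s+1))
          / ((Nat.doubleFactorial (2*s + 1) : ℝ) / (2 * 4 ^ (2*s+1))
              * ((n : ℝ) / 4 ^ (r - 1)) ^ (-(s : ℤ) - 1)))
      atTop (𝓝 1) := by
  obtain ⟨r, rfl⟩ := Nat.exists_eq_add_of_le' hr
  set A : ℝ := (Nat.doubleFactorial (2 * s + 1) : ℝ) / (2 * 4 ^ (2 * s + 1)) with hA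
  have hA0 : A ≠ 0 := by
    have := Nat.doubleFactorial_pos (2 * s + 1)
    positivity
  have hK : A * (4 ^ r) ^ (s + 1) ≠ 0 := by positivity
  have h := (tendsto_pow_mul_expect_bifurcation r s).div_const (A * (4 ^ r) ^ (s + 1))
  rw [← hA, div_self hK] at h
  refine h.congr' ?_
  filter_upwards [eventually_ge_atTop 1] with n hn
  have hn0 : (n : ℝ) ≠ 0 := by positivity
  have e : ((n : ℝ) / 4 ^ (r + 1 - 1)) ^ (-(s : ℤ) - 1) = (4 ^ r) ^ (s + 1) / (n : ℝ) ^ (s + 1) := by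
    rw [show -(s : ℤ) - 1 = -((s + 1 : ℕ) : ℤ) by push_cast; ring, zpow_neg, zpow_natCast,
      Nat.add_sub_cancel, div_pow, inv_div]
  rw [e, mul_div_assoc', div_div_eq_mul_div, mul_comm]
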